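/- Let q ∈ (1,∞), σ ∈ (1/q, 1), and 0 ≤ ε < σ − 1/q. There is a constant C = C(q,σ,ε,M) > 0, independent of T, such that for every T > 0 and all continuous u : [0,T] → X and v : [0,T] → Y with u(0) = 0, v(0) = 0, and finite W_q^σ norms, one has ‖uv‖_{W_q^σ((0,T),Z)} ≤ C·T^ε·‖u‖_{W_q^σ((0,T),X)}·‖v‖_{W_q^σ((0,T),Y)}. -/

import Mathlib

open MeasureTheory Set ENNReal

/-- The `W_q^σ((0,T),X)` Sobolev–Slobodeckii norm, valued in `ℝ≥0∞`. -/
noncomputable def wsNorm {X : Type*} [NormedAddCommGroup X] (q σ T : ℝ) (u : ℝ → X) : ℝ≥0∞ :=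
  (∫⁻ t in Ioo (0:ℝ) T, (‖u t‖₊ : ℝ≥0∞) ^ q) ^ (1 / q) +
    (∫⁻ t in Ioo (0:ℝ) T, ∫⁻ s in Ioo (0:ℝ) T,
        (‖u t - u s‖₊ : ℝ≥0∞) ^ q / (ENNReal.ofReal |t - s|) ^ (1 + σ * q)) ^ (1 / q)

/-- The `L_∞(0,T;X)` norm (essential supremum), valued in `ℝ≥0∞`. -/
noncomputable def linfNorm {X : Type*} [NormedAddCommGroup X] (T : ℝ) (u : ℝ → X) : ℝ≥0∞ :=
  essSup (fun t => (‖u t‖₊ : ℝ≥0∞)) (volume.restrict (Ioo (0:ℝ) T))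

/-- The `C^ρ([0,T],X)` Hölder norm, valued in `ℝ≥0∞`. -/
noncomputable def cHolderNorm {X : Type*} [NormedAddCommGroup X] (ρ T : ℝ) (u : ℝ → X) : ℝ≥0∞ :=
  (⨆ t ∈ Icc (0:ℝ) T, (‖u t‖₊ : ℝ≥0∞)) +
    ⨆ t ∈ Icc (0:ℝ) T, ⨆ s ∈ Icc (0:ℝ) T, ⨆ _ : t ≠ s,
      (‖u t - u s‖₊ : ℝ≥0∞) / (ENNReal.ofReal |t - s|) ^ ρ

/-- The Gagliardo seminorm part of `wsNorm`. -/
noncomputable def wsSeminorm {X : Type*} [NormedAddCommGroup X] (q σ T : ℝ) (u : ℝ → X) : ℝ≥0∞ :=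
  (∫⁻ t in Ioo (0:ℝ) T, ∫⁻ s in Ioo (0:ℝ) T,
    ‖u t - u s‖ₑ ^ q / (ENNReal.ofReal |t - s|) ^ (1 + σ * q)) ^ (1 / q)

/-- The uniform probability measure on the interval `(a, b)`. -/
noncomputable def unifIoo (a b : ℝ) : Measure ℝ :=
  (ENNReal.ofReal (b - a))⁻¹ • volume.restrict (Ioo a b)

instance (a b : ℝ) : SFinite (unifIoo a b) := by
  unfold unifIoo; infer_instance

theorem isProbabilityMeasure_unifIoo {a b : ℝ} (hab : a < b) :
    IsProbabilityMeasure (unifIoo a b) := by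
  constructor
  simp only [unifIoo, Measure.smul_apply, Measure.restrict_apply_univ, Real.volume_Ioo,
    smul_eq_mul]
  exact ENNReal.inv_mul_cancel (by simpa using hab) ENNReal.ofReal_ne_top

theorem lintegral_unifIoo (a b : ℝ) (f : ℝ → ℝ≥0∞) :
    ∫⁻ x, f x ∂unifIoo a b = (ENNReal.ofReal (b - a))⁻¹ * ∫⁻ x in Ioo a b, f x := by
  rw [unifIoo, lintegral_smul_measure, smul_eq_mul]

theorem lintegral_unifIoo_mono {a b : ℝ} {f g : ℝ → ℝ≥0∞} (h : ∀ x ∈ Ioo a b, f x ≤ g x) :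
    ∫⁻ x, f x ∂unifIoo a b ≤ ∫⁻ x, g x ∂unifIoo a b := by
  rw [lintegral_unifIoo, lintegral_unifIoo]
  gcongr 1
  exact setLIntegral_mono' measurableSet_Ioo h

theorem le_lintegral_unifIoo {a b : ℝ} (hab : a < b) {c : ℝ≥0∞} {f : ℝ → ℝ≥0∞}
    (h : ∀ x ∈ Ioo a b, c ≤ f x) : c ≤ ∫⁻ x, f x ∂unifIoo a b := by
  have := isProbabilityMeasure_unifIoo hab
  simpa using lintegral_unifIoo_mono h

theorem lintegral_unifIoo_le {a b : ℝ} (hab : a < b) {c : ℝ≥0∞} {f : ℝ → ℝ≥0∞}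
    (h : ∀ x ∈ Ioo a b, f x ≤ c) : ∫⁻ x, f x ∂unifIoo a b ≤ c := by
  have := isProbabilityMeasure_unifIoo hab
  simpa using lintegral_unifIoo_mono h

theorem lintegral_le_rpow_lintegral {α : Type*} [MeasurableSpace α] (μ : Measure α)
    [IsProbabilityMeasure μ] {f : α → ℝ≥0∞} (hf : Measurable f) {q : ℝ} (hq : 1 ≤ q) :
    ∫⁻ x, f x ∂μ ≤ (∫⁻ x, f x ^ q ∂μ) ^ (1 / q) := by
  simpa [eLpNorm'] using
    eLpNorm'_le_eLpNorm'_of_exponent_le one_pos hq μ hf.aestronglyMeasurable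

theorem rpow_lintegral_le_lintegral_rpow {α : Type*} [MeasurableSpace α] (μ : Measure α)
    [IsProbabilityMeasure μ] {f : α → ℝ≥0∞} (hf : Measurable f) {q : ℝ} (hq : 1 ≤ q) :
    (∫⁻ x, f x ∂μ) ^ q ≤ ∫⁻ x, f x ^ q ∂μ := by
  have := lintegral_le_rpow_lintegral μ hf hq
  rwa [one_div, ENNReal.le_rpow_inv_iff (by linarith)] at this

section

variable {X : Type*} [NormedAddCommGroup X]

theorem wsNorm_eq (q σ T : ℝ) (u : ℝ → X) :
    wsNorm q σ T u = (∫⁻ t in Ioo (0:ℝ) T, ‖u t‖ₑ ^ q) ^ (1 / q) + wsSeminorm q σ T u := rfl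

theorem measurable_enorm_sub {u : ℝ → X} (hu : Continuous u) :
    Measurable (Function.uncurry fun y z => ‖u y - u z‖ₑ) := by
  have : Continuous (Function.uncurry fun y z => ‖u y - u z‖ₑ) := by
    unfold Function.uncurry; fun_prop
  exact this.measurable

theorem measurable_wsSeminorm_integrand {q σ : ℝ} {u : ℝ → X} (hu : Continuous u) :
    Measurable (Function.uncurry fun t s =>
      ‖u t - u s‖ₑ ^ q / (ENNReal.ofReal |t - s|) ^ (1 + σ * q)) := by
  have h : Measurable (Function.uncurry fun t s : ℝ =>
      (ENNReal.ofReal |t - s|) ^ (1 + σ * q)) := by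
    unfold Function.uncurry; fun_prop
  exact ((measurable_enorm_sub hu).pow_const q).div h

theorem enorm_sub_rpow_le {q σ ℓ : ℝ} (hq : 1 < q) (hσ : 0 < σ) (u : ℝ → X) {y z : ℝ}
    (h : |y - z| ≤ ℓ) :
    ‖u y - u z‖ₑ ^ q ≤ ENNReal.ofReal ℓ ^ (1 + σ * q) *
      (‖u y - u z‖ₑ ^ q / ENNReal.ofReal |y - z| ^ (1 + σ * q)) := by
  have hp : 0 < 1 + σ * q := by positivity
  rcases eq_or_ne y z with rfl | hyz
  · simp [show 0 < q by linarith]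
  · have h0 : ENNReal.ofReal |y - z| ^ (1 + σ * q) ≠ 0 := by
      simp [ENNReal.rpow_eq_zero_iff, hp.not_gt, sub_eq_zero, hyz]
    have ht : ENNReal.ofReal |y - z| ^ (1 + σ * q) ≠ ⊤ :=
      ENNReal.rpow_ne_top_of_nonneg hp.le ENNReal.ofReal_ne_top
    calc ‖u y - u z‖ₑ ^ q = ENNReal.ofReal |y - z| ^ (1 + σ * q) *
          (‖u y - u z‖ₑ ^ q / ENNReal.ofReal |y - z| ^ (1 + σ * q)) :=
          (ENNReal.mul_div_cancel h0 ht).symm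
      _ ≤ _ := by gcongr

/-- Mean oscillation between an interval and a subinterval of half its length. -/
theorem lintegral_lintegral_unifIoo_le {q σ T : ℝ} (hq : 1 < q) (hσ : 0 < σ) {u : ℝ → X}
    (hu : Continuous u) {a b c d : ℝ} (hcd : c < d) (hI : Ioo a b ⊆ Ioo 0 T)
    (hJ : Ioo c d ⊆ Ioo a b) (hlen : b - a = 2 * (d - c)) :
    ∫⁻ y, ∫⁻ z, ‖u y - u z‖ₑ ∂unifIoo c d ∂unifIoo a b ≤
      2 ^ (1 / q) * ENNReal.ofReal (b - a) ^ (σ - 1 / q) * wsSeminorm q σ T u := by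
  have hq0 : 0 < q := by linarith
  have hab : a < b := by linarith
  have := isProbabilityMeasure_unifIoo hab
  have := isProbabilityMeasure_unifIoo hcd
  have hm := measurable_enorm_sub hu
  set S := ∫⁻ t in Ioo (0:ℝ) T, ∫⁻ s in Ioo (0:ℝ) T,
    ‖u t - u s‖ₑ ^ q / (ENNReal.ofReal |t - s|) ^ (1 + σ * q) with hS
  set ℓ := ENNReal.ofReal (b - a) with hℓ
  have hℓ0 : ℓ ≠ 0 := by simpa [hℓ] using hab
  have hℓt : ℓ ≠ ⊤ := ENNReal.ofReal_ne_top
  have hlc : (ENNReal.ofReal (d - c))⁻¹ = 2 * ℓ⁻¹ := by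
    rw [hℓ, hlen, ENNReal.ofReal_mul zero_le_two, ENNReal.ofReal_ofNat,
      ENNReal.mul_inv (by simp) (by simp), ← mul_assoc, ENNReal.mul_inv_cancel (by simp) (by simp),
      one_mul]
  have key : ∫⁻ y, ∫⁻ z, ‖u y - u z‖ₑ ^ q ∂unifIoo c d ∂unifIoo a b ≤
      2 * ℓ ^ (σ * q - 1) * S := by
    calc ∫⁻ y, ∫⁻ z, ‖u y - u z‖ₑ ^ q ∂unifIoo c d ∂unifIoo a b
        ≤ ∫⁻ y, ∫⁻ z, ℓ ^ (1 + σ * q) *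
          (‖u y - u z‖ₑ ^ q / ENNReal.ofReal |y - z| ^ (1 + σ * q)) ∂unifIoo c d ∂unifIoo a b := by
          refine lintegral_unifIoo_mono fun y hy => lintegral_unifIoo_mono fun z hz => ?_
          refine enorm_sub_rpow_le hq hσ u ?_
          have := hJ hz
          rw [abs_le]
          constructor <;> linarith [hy.1, hy.2, this.1, this.2]
      _ = ℓ ^ (1 + σ * q) * (ℓ⁻¹ * (2 * ℓ⁻¹) * ∫⁻ y in Ioo a b, ∫⁻ z in Ioo c d,
          ‖u y - u z‖ₑ ^ q / ENNReal.ofReal |y - z| ^ (1 + σ * q)) := by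
          have h1 : ℓ ^ (1 + σ * q) ≠ ⊤ := ENNReal.rpow_ne_top_of_nonneg (by positivity) hℓt
          have h2 : 2 * ℓ⁻¹ ≠ ⊤ := ENNReal.mul_ne_top (by simp) (by simpa using hℓ0)
          simp_rw [lintegral_const_mul' _ _ h1, lintegral_unifIoo, hlc]
          rw [lintegral_const_mul' _ _ h2, ← hℓ]
          ring
      _ ≤ ℓ ^ (1 + σ * q) * (ℓ⁻¹ * (2 * ℓ⁻¹) * S) := by
          gcongr
          exact (lintegral_mono fun y => lintegral_mono_set (hJ.trans hI)).trans
            (lintegral_mono_set hI)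
      _ = 2 * (ℓ ^ (1 + σ * q) * ℓ ^ (-1:ℝ) * ℓ ^ (-1:ℝ)) * S := by
          rw [ENNReal.rpow_neg_one]; ring
      _ = _ := by
          rw [← ENNReal.rpow_add _ _ hℓ0 hℓt, ← ENNReal.rpow_add _ _ hℓ0 hℓt]
          ring_nf
  calc ∫⁻ y, ∫⁻ z, ‖u y - u z‖ₑ ∂unifIoo c d ∂unifIoo a b
      ≤ (∫⁻ y, (∫⁻ z, ‖u y - u z‖ₑ ∂unifIoo c d) ^ q ∂unifIoo a b) ^ (1 / q) :=
        lintegral_le_rpow_lintegral _ hm.lintegral_prod_right hq.le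
    _ ≤ (∫⁻ y, ∫⁻ z, ‖u y - u z‖ₑ ^ q ∂unifIoo c d ∂unifIoo a b) ^ (1 / q) := by
        gcongr with y
        exact rpow_lintegral_le_lintegral_rpow _ hm.of_uncurry_left hq.le
    _ ≤ (2 * ℓ ^ (σ * q - 1) * S) ^ (1 / q) := by gcongr
    _ = _ := by
        have h1 : 0 ≤ 1 / q := by positivity
        rw [ENNReal.mul_rpow_of_nonneg _ _ h1, ENNReal.mul_rpow_of_nonneg _ _ h1,
          ← ENNReal.rpow_mul, wsSeminorm]
        congr 3
        field_simp

theorem lintegral_unifIoo_triangle {u : ℝ → X} (hu : Continuous u) {a b c d : ℝ} (hab : a < b)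
    (hcd : c < d) (x : X) :
    ∫⁻ y, ‖x - u y‖ₑ ∂unifIoo a b ≤ ∫⁻ z, ‖x - u z‖ₑ ∂unifIoo c d +
      ∫⁻ y, ∫⁻ z, ‖u y - u z‖ₑ ∂unifIoo c d ∂unifIoo a b := by
  have := isProbabilityMeasure_unifIoo hab
  have hm : Measurable fun z => ‖x - u z‖ₑ := by
    have : Continuous fun z => ‖x - u z‖ₑ := by fun_prop
    exact this.measurable
  calc ∫⁻ y, ‖x - u y‖ₑ ∂unifIoo a b
      ≤ ∫⁻ y, ((∫⁻ z, ‖x - u z‖ₑ ∂unifIoo c d) + ∫⁻ z, ‖u y - u z‖ₑ ∂unifIoo c d)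
        ∂unifIoo a b := by
        refine lintegral_mono fun y => ?_
        rw [← lintegral_add_left hm]
        refine le_lintegral_unifIoo hcd fun z _ => ?_
        simp only [← edist_eq_enorm_sub]
        rw [edist_comm (u y)]
        exact edist_triangle _ _ _
    _ = _ := by rw [lintegral_add_left measurable_const]; simp

/-- Morrey-type estimate: a continuous function deviates from its value at a point of a closed
interval on average by at most the Slobodeckii seminorm times a power of the length. -/
theorem lintegral_unifIoo_enorm_sub_le {q σ T : ℝ} (hq : 1 < q) (hσ : 1 / q < σ) {u : ℝ → X}
    (hu : Continuous u) {a b t : ℝ} (hab : a < b) (ha : 0 ≤ a) (hb : b ≤ T)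
    (ht : t ∈ Icc a b) :
    ∫⁻ y, ‖u t - u y‖ₑ ∂unifIoo a b ≤
      2 ^ (1 / q) * (1 - ENNReal.ofReal (1 / 2) ^ (σ - 1 / q))⁻¹ *
        ENNReal.ofReal (b - a) ^ (σ - 1 / q) * wsSeminorm q σ T u := by
  set α := σ - 1 / q with hα
  have hα0 : 0 < α := sub_pos.2 hσ
  have hσ0 : 0 < σ := lt_trans (by positivity) hσ
  set l : ℕ → ℝ := fun n => t - (t - a) * (1 / 2) ^ n with hl
  set r : ℕ → ℝ := fun n => t + (b - t) * (1 / 2) ^ n with hr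
  have hlen (n : ℕ) : r n - l n = (b - a) * (1 / 2) ^ n := by simp only [hl, hr]; ring
  have hlr (n : ℕ) : l n < r n := by
    rw [← sub_pos, hlen]; have := sub_pos.2 hab; positivity
  have hpow (n : ℕ) : (0:ℝ) ≤ (1 / 2) ^ n := by positivity
  have hta : 0 ≤ t - a := sub_nonneg.2 ht.1
  have hbt : 0 ≤ b - t := sub_nonneg.2 ht.2
  have hle (n : ℕ) : a ≤ l n ∧ r n ≤ b := by
    have : ((1:ℝ) / 2) ^ n ≤ 1 := pow_le_one₀ (by norm_num) (by norm_num)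
    constructor <;> simp only [hl, hr] <;> nlinarith
  have hnest (n : ℕ) : l n ≤ l (n + 1) ∧ r (n + 1) ≤ r n := by
    have := hpow n
    constructor <;> simp only [hl, hr, pow_succ] <;> nlinarith
  set c := 2 ^ (1 / q) * ENNReal.ofReal (b - a) ^ α * wsSeminorm q σ T u with hc
  have hA (n : ℕ) : ∫⁻ y, ∫⁻ z, ‖u y - u z‖ₑ ∂unifIoo (l (n+1)) (r (n+1)) ∂unifIoo (l n) (r n) ≤
      c * (ENNReal.ofReal (1 / 2) ^ α) ^ n := by
    refine (lintegral_lintegral_unifIoo_le (T := T) hq hσ0 hu (hlr (n + 1))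
      (Ioo_subset_Ioo (ha.trans (hle n).1) ((hle n).2.trans hb))
      (Ioo_subset_Ioo (hnest n).1 (hnest n).2) (by rw [hlen, hlen, pow_succ]; ring)).trans
      (le_of_eq ?_)
    rw [hlen, ENNReal.ofReal_mul (by linarith), ENNReal.mul_rpow_of_nonneg _ _ hα0.le,
      ENNReal.ofReal_pow (by norm_num), ← ENNReal.rpow_natCast, ← ENNReal.rpow_natCast,
      ← ENNReal.rpow_mul, ← ENNReal.rpow_mul, mul_comm (n:ℝ) α, hc]
    ring
  have hsum (n : ℕ) : ∫⁻ y, ‖u t - u y‖ₑ ∂unifIoo a b ≤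
      ∫⁻ y, ‖u t - u y‖ₑ ∂unifIoo (l n) (r n) +
        ∑ k ∈ Finset.range n, c * (ENNReal.ofReal (1 / 2) ^ α) ^ k := by
    induction n with
    | zero => simp [hl, hr]
    | succ n ih =>
      refine ih.trans ?_
      rw [Finset.sum_range_succ, add_comm (Finset.sum _ _), ← add_assoc]
      gcongr
      exact (lintegral_unifIoo_triangle hu (hlr n) (hlr (n + 1)) _).trans (by gcongr; exact hA n)
  have hlim (δ : ℝ≥0∞) (hδ : 0 < δ) :
      ∃ n, ∫⁻ y, ‖u t - u y‖ₑ ∂unifIoo (l n) (r n) ≤ δ := by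
    obtain ⟨η, hη, hball⟩ := EMetric.continuous_iff.1 hu t δ hδ
    have hη' : ∃ η' > 0, ∀ y, |y - t| < η' → ‖u t - u y‖ₑ ≤ δ := by
      obtain ⟨η', h0, h1⟩ := ENNReal.lt_iff_exists_real_btwn.1 hη
      refine ⟨η', by simpa using h1.1, fun y hy => ?_⟩
      rw [← edist_eq_enorm_sub, edist_comm]
      refine (hball y ?_).le
      rw [edist_dist, Real.dist_eq]
      exact (ENNReal.ofReal_le_ofReal hy.le).trans_lt h1.2
    obtain ⟨η', h0, h1⟩ := hη'
    obtain ⟨n, hn⟩ := exists_pow_lt_of_lt_one (div_pos h0 (sub_pos.2 hab))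
      (show (1 / 2 : ℝ) < 1 by norm_num)
    refine ⟨n, lintegral_unifIoo_le (hlr n) fun y hy => h1 y ?_⟩
    rw [lt_div_iff₀ (sub_pos.2 hab), mul_comm, ← hlen] at hn
    have hlt : l n ≤ t ∧ t ≤ r n := by
      have := hpow n
      constructor <;> simp only [hl, hr] <;> nlinarith
    rw [abs_lt]
    constructor <;> linarith [hy.1, hy.2, hlt.1, hlt.2]
  have hgeom (n : ℕ) : ∑ k ∈ Finset.range n, c * (ENNReal.ofReal (1 / 2) ^ α) ^ k ≤
      c * (1 - ENNReal.ofReal (1 / 2) ^ α)⁻¹ := by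
    rw [← ENNReal.tsum_geometric, ← ENNReal.tsum_mul_left]
    exact ENNReal.sum_le_tsum _
  calc ∫⁻ y, ‖u t - u y‖ₑ ∂unifIoo a b ≤ c * (1 - ENNReal.ofReal (1 / 2) ^ α)⁻¹ := by
        refine ENNReal.le_of_forall_pos_le_add fun δ hδ _ => ?_
        obtain ⟨n, hn⟩ := hlim δ (by exact_mod_cast hδ)
        rw [add_comm]
        exact (hsum n).trans (add_le_add hn (hgeom n))
    _ = _ := by rw [hc]; ring

/-- The constant in the Morrey-type estimate `lintegral_unifIoo_enorm_sub_le`. -/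
noncomputable def morreyConst (q σ : ℝ) : ℝ≥0∞ :=
  2 ^ (1 / q) * (1 - ENNReal.ofReal (1 / 2) ^ (σ - 1 / q))⁻¹

theorem morreyConst_ne_top {q σ : ℝ} (hq : 1 < q) (hσ : 1 / q < σ) : morreyConst q σ ≠ ⊤ := by
  refine ENNReal.mul_ne_top (ENNReal.rpow_ne_top_of_nonneg (by positivity) (by simp)) ?_
  rw [ENNReal.inv_ne_top, ne_eq, tsub_eq_zero_iff_le, not_le]
  refine ENNReal.rpow_lt_one ?_ (sub_pos.2 hσ)
  rw [ENNReal.ofReal_lt_one]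
  norm_num

/-- Sobolev embedding into the bounded functions, with a constant that is uniform in `T`. -/
theorem enorm_le_wsNorm {q σ ε T : ℝ} (hq : 1 < q) (hσ : 1 / q < σ) (hε0 : 0 ≤ ε)
    (hε1 : ε < σ - 1 / q) (hT : 0 < T) {u : ℝ → X} (hu : Continuous u) (h0 : u 0 = 0)
    {t : ℝ} (ht : t ∈ Icc 0 T) :
    ‖u t‖ₑ ≤ (2 * morreyConst q σ + 1) * ENNReal.ofReal (T ^ ε) * wsNorm q σ T u := by
  set K := morreyConst q σ with hK
  have hm (x : X) : Measurable fun y => ‖x - u y‖ₑ := by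
    have : Continuous fun y => ‖x - u y‖ₑ := by fun_prop
    exact this.measurable
  have hSW : wsSeminorm q σ T u ≤ wsNorm q σ T u := by rw [wsNorm_eq]; exact le_add_self
  rcases le_total T 1 with hT1 | hT1
  · have hTα : ENNReal.ofReal (T - 0) ^ (σ - 1 / q) ≤ ENNReal.ofReal (T ^ ε) := by
      rw [sub_zero, ENNReal.ofReal_rpow_of_pos hT]
      exact ENNReal.ofReal_le_ofReal (Real.rpow_le_rpow_of_exponent_ge hT hT1 hε1.le)
    have h1 := lintegral_unifIoo_enorm_sub_le hq hσ hu hT le_rfl le_rfl ht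
    have h2 := lintegral_unifIoo_enorm_sub_le hq hσ hu hT le_rfl le_rfl (left_mem_Icc.2 hT.le)
    calc ‖u t‖ₑ ≤ ∫⁻ y, (‖u t - u y‖ₑ + ‖u 0 - u y‖ₑ) ∂unifIoo 0 T := by
          refine le_lintegral_unifIoo hT fun y _ => ?_
          rw [h0]
          simp only [← edist_eq_enorm_sub]
          rw [edist_comm 0 (u y), ← edist_zero_right]
          exact edist_triangle _ _ _
      _ ≤ K * ENNReal.ofReal (T - 0) ^ (σ - 1 / q) * wsSeminorm q σ T u +
          K * ENNReal.ofReal (T - 0) ^ (σ - 1 / q) * wsSeminorm q σ T u := by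
          rw [lintegral_add_left (hm _)]
          exact add_le_add h1 h2
      _ = 2 * K * ENNReal.ofReal (T - 0) ^ (σ - 1 / q) * wsSeminorm q σ T u := by ring
      _ ≤ _ := by
          gcongr
          exact le_self_add
  · obtain ⟨a, ha0, haT, hta⟩ : ∃ a : ℝ, 0 ≤ a ∧ a + 1 ≤ T ∧ t ∈ Icc a (a + 1) := by
      rcases le_total t 1 with h | h
      · exact ⟨0, le_rfl, by simpa using hT1, ht.1, by simpa using h⟩
      · exact ⟨t - 1, by linarith, by linarith [ht.2], by linarith, by linarith⟩
    have hlt : a < a + 1 := by linarith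
    have := isProbabilityMeasure_unifIoo hlt
    have h1 := lintegral_unifIoo_enorm_sub_le hq hσ hu hlt ha0 haT hta
    have h2 : ∫⁻ y, ‖u y‖ₑ ∂unifIoo a (a + 1) ≤ wsNorm q σ T u := by
      have hmu : Measurable fun y => ‖u y‖ₑ := by simpa using hm 0
      refine (lintegral_le_rpow_lintegral _ hmu hq.le).trans ?_
      rw [wsNorm_eq, lintegral_unifIoo]
      refine le_add_right ?_
      have : (ENNReal.ofReal (a + 1 - a))⁻¹ = 1 := by simp
      rw [this, one_mul]
      gcongr 1
      exact lintegral_mono_set (Ioo_subset_Ioo ha0 haT)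
    calc ‖u t‖ₑ ≤ ∫⁻ y, (‖u t - u y‖ₑ + ‖u y‖ₑ) ∂unifIoo a (a + 1) := by
          refine le_lintegral_unifIoo hlt fun y _ => ?_
          simpa using enorm_add_le (u t - u y) (u y)
      _ ≤ K * ENNReal.ofReal (a + 1 - a) ^ (σ - 1 / q) * wsSeminorm q σ T u +
          wsNorm q σ T u := by
          rw [lintegral_add_left (hm _)]
          exact add_le_add h1 h2
      _ ≤ K * wsNorm q σ T u + wsNorm q σ T u := by
          have : ENNReal.ofReal (a + 1 - a) = 1 := by simp
          rw [this, ENNReal.one_rpow, mul_one]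
          gcongr
      _ = (1 * K + 1) * 1 * wsNorm q σ T u := by ring
      _ ≤ _ := by
          gcongr
          · exact one_le_two
          · rw [ENNReal.one_le_ofReal]
            exact Real.one_le_rpow hT1 hε0

theorem wsNorm_congr {q σ T : ℝ} {u v : ℝ → X} (h : EqOn u v (Icc 0 T)) :
    wsNorm q σ T u = wsNorm q σ T v := by
  have h' : EqOn u v (Ioo 0 T) := h.mono Ioo_subset_Icc_self
  unfold wsNorm
  congr 2
  · exact setLIntegral_congr_fun measurableSet_Ioo fun t ht => by simp only [h' ht]
  · refine setLIntegral_congr_fun measurableSet_Ioo fun t ht => ?_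
    refine setLIntegral_congr_fun measurableSet_Ioo fun s hs => ?_
    simp only [h' ht, h' hs]

end

theorem enorm_bilin_le {X Y Z : Type*} [NormedAddCommGroup X] [NormedSpace ℝ X]
    [NormedAddCommGroup Y] [NormedSpace ℝ Y] [NormedAddCommGroup Z] [NormedSpace ℝ Z]
    {B : X →ₗ[ℝ] Y →ₗ[ℝ] Z} {M : ℝ} (hB : ∀ x y, ‖B x y‖ ≤ M * ‖x‖ * ‖y‖) (x : X) (y : Y) :
    ‖B x y‖ₑ ≤ ENNReal.ofReal M * ‖x‖ₑ * ‖y‖ₑ := by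
  rw [← ofReal_norm, ← ofReal_norm x, ← ofReal_norm y,
    ← ENNReal.ofReal_mul' (norm_nonneg _), ← ENNReal.ofReal_mul' (norm_nonneg _)]
  exact ENNReal.ofReal_le_ofReal (hB x y)

theorem lintegral_rpow_le_of_le_const_mul {q T : ℝ} (hq : 1 < q) {f g : ℝ → ℝ≥0∞} {c : ℝ≥0∞}
    (hg : Measurable g) (h : ∀ t ∈ Ioo 0 T, f t ≤ c * g t) :
    (∫⁻ t in Ioo 0 T, f t ^ q) ^ (1 / q) ≤ c * (∫⁻ t in Ioo 0 T, g t ^ q) ^ (1 / q) := by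
  have hq0 : 0 < q := by linarith
  calc (∫⁻ t in Ioo 0 T, f t ^ q) ^ (1 / q) ≤ (∫⁻ t in Ioo 0 T, c ^ q * g t ^ q) ^ (1 / q) := by
        gcongr 1
        refine setLIntegral_mono' measurableSet_Ioo fun t ht => ?_
        rw [← ENNReal.mul_rpow_of_nonneg _ _ hq0.le]
        gcongr
        exact h t ht
    _ = _ := by
        rw [lintegral_const_mul _ (by fun_prop), ENNReal.mul_rpow_of_nonneg _ _ (by positivity),
          ← ENNReal.rpow_mul, mul_one_div_cancel hq0.ne', ENNReal.rpow_one]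

theorem wsSeminorm_le_of_enorm_sub_le {X Y Z : Type*} [NormedAddCommGroup X]
    [NormedAddCommGroup Y] [NormedAddCommGroup Z] {q σ T : ℝ} (hq : 1 < q)
    {u : ℝ → X} {v : ℝ → Y} {w : ℝ → Z} (hu : Continuous u) (hv : Continuous v) {a b : ℝ≥0∞}
    (h : ∀ t ∈ Ioo 0 T, ∀ s ∈ Ioo 0 T, ‖w t - w s‖ₑ ≤ a * ‖u t - u s‖ₑ + b * ‖v t - v s‖ₑ) :
    wsSeminorm q σ T w ≤ 2 * (a * wsSeminorm q σ T u + b * wsSeminorm q σ T v) := by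
  have hq0 : 0 < q := by linarith
  have hq1 : 0 ≤ 1 / q := by positivity
  have hmu := measurable_wsSeminorm_integrand (q := q) (σ := σ) hu
  have hmv := measurable_wsSeminorm_integrand (q := q) (σ := σ) hv
  have hpt : ∀ t ∈ Ioo 0 T, ∀ s ∈ Ioo 0 T,
      ‖w t - w s‖ₑ ^ q / (ENNReal.ofReal |t - s|) ^ (1 + σ * q) ≤
      2 ^ q * a ^ q * (‖u t - u s‖ₑ ^ q / (ENNReal.ofReal |t - s|) ^ (1 + σ * q)) +
      2 ^ q * b ^ q * (‖v t - v s‖ₑ ^ q / (ENNReal.ofReal |t - s|) ^ (1 + σ * q)) := by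
    intro t ht s hs
    rw [← mul_div_assoc, ← mul_div_assoc, ← ENNReal.add_div]
    gcongr
    calc ‖w t - w s‖ₑ ^ q ≤ (a * ‖u t - u s‖ₑ + b * ‖v t - v s‖ₑ) ^ q := by
          gcongr; exact h t ht s hs
      _ ≤ 2 ^ (q - 1) * ((a * ‖u t - u s‖ₑ) ^ q + (b * ‖v t - v s‖ₑ) ^ q) :=
          ENNReal.rpow_add_le_mul_rpow_add_rpow _ _ hq.le
      _ ≤ 2 ^ q * ((a * ‖u t - u s‖ₑ) ^ q + (b * ‖v t - v s‖ₑ) ^ q) := by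
          gcongr
          · exact one_le_two
          · linarith
      _ = _ := by
          rw [ENNReal.mul_rpow_of_nonneg _ _ hq0.le, ENNReal.mul_rpow_of_nonneg _ _ hq0.le]
          ring
  have hroot (c x : ℝ≥0∞) : (2 ^ q * c ^ q * x) ^ (1 / q) = 2 * (c * x ^ (1 / q)) := by
    rw [ENNReal.mul_rpow_of_nonneg _ _ hq1, ENNReal.mul_rpow_of_nonneg _ _ hq1,
      ← ENNReal.rpow_mul, ← ENNReal.rpow_mul, mul_one_div_cancel hq0.ne', ENNReal.rpow_one,
      ENNReal.rpow_one, mul_assoc]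
  calc wsSeminorm q σ T w
      ≤ (∫⁻ t in Ioo (0:ℝ) T, ∫⁻ s in Ioo (0:ℝ) T,
        (2 ^ q * a ^ q * (‖u t - u s‖ₑ ^ q / (ENNReal.ofReal |t - s|) ^ (1 + σ * q)) +
        2 ^ q * b ^ q * (‖v t - v s‖ₑ ^ q / (ENNReal.ofReal |t - s|) ^ (1 + σ * q))))
          ^ (1 / q) := by
        unfold wsSeminorm
        gcongr 1
        exact setLIntegral_mono' measurableSet_Ioo fun t ht =>
          setLIntegral_mono' measurableSet_Ioo fun s hs => hpt t ht s hs
    _ = (2 ^ q * a ^ q * (∫⁻ t in Ioo (0:ℝ) T, ∫⁻ s in Ioo (0:ℝ) T,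
          (‖u t - u s‖ₑ ^ q / (ENNReal.ofReal |t - s|) ^ (1 + σ * q))) +
        2 ^ q * b ^ q * (∫⁻ t in Ioo (0:ℝ) T, ∫⁻ s in Ioo (0:ℝ) T,
          (‖v t - v s‖ₑ ^ q / (ENNReal.ofReal |t - s|) ^ (1 + σ * q)))) ^ (1 / q) := by
        rw [← lintegral_const_mul _ hmu.lintegral_prod_right,
          ← lintegral_const_mul _ hmv.lintegral_prod_right,
          ← lintegral_add_left (hmu.lintegral_prod_right.const_mul _)]
        congr 1
        refine lintegral_congr fun t => ?_
        rw [lintegral_add_left (hmu.of_uncurry_left.const_mul _),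
          lintegral_const_mul _ hmu.of_uncurry_left, lintegral_const_mul _ hmv.of_uncurry_left]
    _ ≤ _ := ENNReal.rpow_add_le_add_rpow _ _ hq1 (by rw [div_le_one hq0]; exact hq.le)
    _ = _ := by rw [hroot, hroot, ← mul_add]; rfl

theorem wsNorm_bilin_le {X Y Z : Type*} [NormedAddCommGroup X] [NormedSpace ℝ X]
    [NormedAddCommGroup Y] [NormedSpace ℝ Y] [NormedAddCommGroup Z] [NormedSpace ℝ Z]
    {B : X →ₗ[ℝ] Y →ₗ[ℝ] Z} {M : ℝ} (hB : ∀ x y, ‖B x y‖ ≤ M * ‖x‖ * ‖y‖)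
    {q σ T : ℝ} (hq : 1 < q) {u : ℝ → X} {v : ℝ → Y} (hu : Continuous u) (hv : Continuous v)
    {P : ℝ≥0∞} (hPu : ∀ t ∈ Icc 0 T, ‖u t‖ₑ ≤ P * wsNorm q σ T u)
    (hPv : ∀ t ∈ Icc 0 T, ‖v t‖ₑ ≤ P * wsNorm q σ T v) :
    wsNorm q σ T (fun t => B (u t) (v t)) ≤
      5 * ENNReal.ofReal M * P * wsNorm q σ T u * wsNorm q σ T v := by
  set U := wsNorm q σ T u with hU
  set V := wsNorm q σ T v with hV
  set m := ENNReal.ofReal M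
  have hIoo : Ioo 0 T ⊆ Icc 0 T := Ioo_subset_Icc_self
  have hvm : Measurable fun t => ‖v t‖ₑ := by
    have : Continuous fun t => ‖v t‖ₑ := by fun_prop
    exact this.measurable
  have h1 : (∫⁻ t in Ioo 0 T, ‖B (u t) (v t)‖ₑ ^ q) ^ (1 / q) ≤ m * (P * U) * V := by
    refine (lintegral_rpow_le_of_le_const_mul hq hvm (c := m * (P * U)) fun t ht => ?_).trans ?_
    · refine (enorm_bilin_le hB _ _).trans ?_
      gcongr
      exact hPu t (hIoo ht)
    · gcongr
      rw [hV, wsNorm_eq]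
      exact le_self_add
  have h2 : wsSeminorm q σ T (fun t => B (u t) (v t)) ≤
      2 * (m * (P * V) * U + m * (P * U) * V) := by
    refine (wsSeminorm_le_of_enorm_sub_le hq hu hv (a := m * (P * V)) (b := m * (P * U))
      fun t ht s hs => ?_).trans ?_
    · have hsplit : B (u t) (v t) - B (u s) (v s) =
          B (u t - u s) (v t) + B (u s) (v t - v s) := by
        simp only [map_sub, LinearMap.sub_apply]; abel
      rw [hsplit]
      refine (enorm_add_le _ _).trans (add_le_add ?_ ?_)
      · refine (enorm_bilin_le hB _ _).trans ?_
        rw [mul_right_comm]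
        gcongr
        exact hPv t (hIoo ht)
      · refine (enorm_bilin_le hB _ _).trans ?_
        gcongr
        exact hPu s (hIoo hs)
    · gcongr
      · rw [hU, wsNorm_eq]; exact le_add_self
      · rw [hV, wsNorm_eq]; exact le_add_self
  rw [wsNorm_eq]
  exact (add_le_add h1 h2).trans (le_of_eq (by ring))

theorem statement9 {X Y Z : Type*}
    [NormedAddCommGroup X] [NormedSpace ℝ X] [CompleteSpace X]
    [NormedAddCommGroup Y] [NormedSpace ℝ Y] [CompleteSpace Y]
    [NormedAddCommGroup Z] [NormedSpace ℝ Z] [CompleteSpace Z]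
    (B : X →ₗ[ℝ] Y →ₗ[ℝ] Z) (M : ℝ) (hB : ∀ x y, ‖B x y‖ ≤ M * ‖x‖ * ‖y‖)
    (q σ ε : ℝ) (hq : 1 < q) (hσ1 : 1 / q < σ) (hσ2 : σ < 1)
    (hε0 : 0 ≤ ε) (hε1 : ε < σ - 1 / q) :
    ∃ C > (0 : ℝ), ∀ T > (0 : ℝ), ∀ u : ℝ → X, ∀ v : ℝ → Y,
      ContinuousOn u (Icc (0:ℝ) T) → u 0 = 0 → wsNorm q σ T u < ⊤ →
      ContinuousOn v (Icc (0:ℝ) T) → v 0 = 0 → wsNorm q σ T v < ⊤ →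
      wsNorm q σ T (fun t => B (u t) (v t)) ≤
        ENNReal.ofReal C * ENNReal.ofReal (T ^ ε) * wsNorm q σ T u * wsNorm q σ T v := by
  set K := 2 * morreyConst q σ + 1
  have hK : 5 * ENNReal.ofReal M * K ≠ ⊤ :=
    ENNReal.mul_ne_top (ENNReal.mul_ne_top (by simp) ENNReal.ofReal_ne_top)
      (ENNReal.add_ne_top.2 ⟨ENNReal.mul_ne_top (by simp) (morreyConst_ne_top hq hσ1), by simp⟩)
  refine ⟨(5 * ENNReal.ofReal M * K).toReal + 1, by positivity, ?_⟩
  intro T hT u v hu hu0 _ hv hv0 _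
  have hC : 5 * ENNReal.ofReal M * K ≤
      ENNReal.ofReal ((5 * ENNReal.ofReal M * K).toReal + 1) := by
    conv_lhs => rw [← ENNReal.ofReal_toReal hK]
    exact ENNReal.ofReal_le_ofReal (by linarith)
  have h0 : (0:ℝ) ∈ Icc 0 T := left_mem_Icc.2 hT.le
  set u' : ℝ → X := IccExtend hT.le ((Icc 0 T).domRestrict u)
  set v' : ℝ → Y := IccExtend hT.le ((Icc 0 T).domRestrict v)
  have huu : EqOn u u' (Icc 0 T) := fun t ht => by simp [u', IccExtend_of_mem _ _ ht]
  have hvv : EqOn v v' (Icc 0 T) := fun t ht => by simp [v', IccExtend_of_mem _ _ ht]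
  have hu' : Continuous u' := hu.domRestrict.Icc_extend'
  have hv' : Continuous v' := hv.domRestrict.Icc_extend'
  have hBB : EqOn (fun t => B (u t) (v t)) (fun t => B (u' t) (v' t)) (Icc 0 T) :=
    fun t ht => by simp only [huu ht, hvv ht]
  rw [wsNorm_congr huu, wsNorm_congr hvv, wsNorm_congr hBB]
  calc wsNorm q σ T (fun t => B (u' t) (v' t))
      ≤ 5 * ENNReal.ofReal M * (K * ENNReal.ofReal (T ^ ε)) * wsNorm q σ T u' *
        wsNorm q σ T v' :=
        wsNorm_bilin_le hB hq hu' hv'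
          (fun t ht => enorm_le_wsNorm hq hσ1 hε0 hε1 hT hu' ((huu h0).symm.trans hu0) ht)
          (fun t ht => enorm_le_wsNorm hq hσ1 hε0 hε1 hT hv' ((hvv h0).symm.trans hv0) ht)
    _ = 5 * ENNReal.ofReal M * K * ENNReal.ofReal (T ^ ε) * wsNorm q σ T u' *
        wsNorm q σ T v' := by ring
    _ ≤ _ := by gcongr
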